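/- arXiv:1706.03132 — 2 statements merged into one kernel-verified Lean document; each statement's English description precedes it below -/
import Mathlib

section
/- Let Γ be a distance-regular graph with diameter D ≥ 3 and fix a base vertex x. For 0 ≤ h,i,j,r,s,t ≤ D, ⟨A_iE_j*A_h, A_rE_s*A_t⟩ = Σ_{ℓ=0}^D k_ℓ p^ℓ_{ir} p^ℓ_{js} p^ℓ_{ht}. -/
open Matrix BigOperators

noncomputable section

structure DRG (X : Type) [Fintype X] [DecidableEq X] where
  G : SimpleGraph X
  D : ℕ
  hD : 3 ≤ D
  hconn : G.Connected
  hdiam_le : ∀ y z : X, G.dist y z ≤ D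
  hdiam : ∃ y z : X, G.dist y z = D
  p : ℕ → ℕ → ℕ → ℕ
  hp : ∀ h i j : ℕ, h ≤ D → i ≤ D → j ≤ D → ∀ y z : X, G.dist y z = h →
    Nat.card {w : X // G.dist y w = i ∧ G.dist z w = j} = p h i j

namespace DRG

variable {X : Type} [Fintype X] [DecidableEq X]

/-- The `i`-th distance matrix. -/
def A (Γ : DRG X) (i : ℕ) : Matrix X X ℂ :=
  Matrix.of fun y z => if Γ.G.dist y z = i then (1 : ℂ) else 0

/-- `c_i`, with the conventions `c_0 = 0` and `c_{D+1} = 1`. -/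
def cI (Γ : DRG X) (i : ℕ) : ℕ :=
  if i = 0 then 0 else if i ≤ Γ.D then Γ.p i 1 (i - 1) else 1

/-- `a_i`. -/
def aI (Γ : DRG X) (i : ℕ) : ℕ := Γ.p i 1 i

/-- `b_i`, with the convention `b_D = 0`. -/
def bI (Γ : DRG X) (i : ℕ) : ℕ := if i < Γ.D then Γ.p i 1 (i + 1) else 0

/-- `k_i`. -/
def kI (Γ : DRG X) (i : ℕ) : ℕ := Γ.p 0 i i

/-- The valency `k = b_0`. -/
def kval (Γ : DRG X) : ℕ := Γ.p 0 1 1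

/-- `Γ` is primitive: each distance-`i` graph is connected. -/
def Primitive (Γ : DRG X) : Prop :=
  ∀ i : ℕ, 1 ≤ i → i ≤ Γ.D →
    (SimpleGraph.fromRel fun y z => Γ.G.dist y z = i).Connected

/-- The Hermitean inner product `⟨R,S⟩ = tr(Rᵗ S̄)`. -/
def inn (R S : Matrix X X ℂ) : ℂ := (Rᵀ * S.map (starRingEnd ℂ)).trace

/-- The dual idempotent `E_i*` with respect to the base vertex `x`. -/
def Estar (Γ : DRG X) (x : X) (i : ℕ) : Matrix X X ℂ :=
  Matrix.diagonal fun y => if Γ.G.dist x y = i then (1 : ℂ) else 0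

/-- The polynomials `v_i`. -/
def vpoly (Γ : DRG X) : ℕ → Polynomial ℝ
  | 0 => 1
  | 1 => Polynomial.X
  | n + 2 =>
      ((Γ.cI (n + 2) : ℝ))⁻¹ •
        (Polynomial.X * vpoly Γ (n + 1) - (Γ.aI (n + 1) : ℝ) • vpoly Γ (n + 1)
          - (Γ.bI n : ℝ) • vpoly Γ n)

/-- The polynomials `u_i = v_i / k_i`. -/
def upoly (Γ : DRG X) (i : ℕ) : Polynomial ℝ := ((Γ.kI i : ℝ))⁻¹ • Γ.vpoly i

end DRG

/-- A system of primitive idempotents (with eigenvalues and Krein parameters) for `Γ`. -/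
structure IdemSys {X : Type} [Fintype X] [DecidableEq X] (Γ : DRG X) where
  E : Fin (Γ.D + 1) → Matrix X X ℂ
  θ : Fin (Γ.D + 1) → ℝ
  q : Fin (Γ.D + 1) → Fin (Γ.D + 1) → Fin (Γ.D + 1) → ℝ
  hE0 : E 0 = ((Fintype.card X : ℂ))⁻¹ • Matrix.of fun _ _ => (1 : ℂ)
  hEsum : ∑ i, E i = 1
  hEmul : ∀ i j, E i * E j = if i = j then E i else 0
  hEsymm : ∀ i, (E i)ᵀ = E i
  hEreal : ∀ i, (E i).map (starRingEnd ℂ) = E i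
  hEbasis : ∀ i, E i ∈ Submodule.span ℂ (Set.range fun n : Fin (Γ.D + 1) => Γ.A (n : ℕ))
  hEig : ∀ j, Γ.A 1 * E j = (θ j : ℂ) • E j
  hθ0 : θ 0 = (Γ.kval : ℝ)
  hθinj : Function.Injective θ
  hKrein : ∀ i j, Matrix.hadamard (E i) (E j) =
    ((Fintype.card X : ℂ))⁻¹ • ∑ h, (q h i j : ℂ) • E h

namespace IdemSys

variable {X : Type} [Fintype X] [DecidableEq X] {Γ : DRG X}

/-- `m_j`, the rank of `E_j`. -/
def m (I : IdemSys Γ) (j : Fin (Γ.D + 1)) : ℕ := (I.E j).rank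

/-- The dual distance matrix `A_i*` with respect to `x` and `E_i`. -/
def Astar (I : IdemSys Γ) (x : X) (i : Fin (Γ.D + 1)) : Matrix X X ℂ :=
  Matrix.diagonal fun y => (Fintype.card X : ℂ) * I.E i x y

end IdemSys

/-- `Γ` is Q-polynomial with respect to the ordering `E_{σ 0}, ..., E_{σ D}`. -/
def QPolyOrdering {X : Type} [Fintype X] [DecidableEq X] {Γ : DRG X} (I : IdemSys Γ)
    (σ : Equiv.Perm (Fin (Γ.D + 1))) : Prop :=
  ∀ h i j : Fin (Γ.D + 1),
    (((i : ℕ) + (j : ℕ) < (h : ℕ) ∨ (h : ℕ) + (j : ℕ) < (i : ℕ) ∨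
        (h : ℕ) + (i : ℕ) < (j : ℕ)) → I.q (σ h) (σ i) (σ j) = 0) ∧
    (((h : ℕ) = (i : ℕ) + (j : ℕ) ∨ (i : ℕ) = (h : ℕ) + (j : ℕ) ∨
        (j : ℕ) = (h : ℕ) + (i : ℕ)) → I.q (σ h) (σ i) (σ j) ≠ 0)

/-- The matrix `S^alt`. -/
def salt {n : ℕ} (S : Matrix (Fin (n + 1)) (Fin (n + 1)) ℂ) : Matrix (Fin n) (Fin n) ℂ :=
  Matrix.of fun i j => S i.succ j.succ - S 0 j.succ

/-- The matrix `(S^{-1})^alt`. -/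
def altInv {n : ℕ} (T : Matrix (Fin (n + 1)) (Fin (n + 1)) ℂ) : Matrix (Fin n) (Fin n) ℂ :=
  Matrix.of fun i j => T i.succ j.succ

/-- The `4D` matrices `A_2E_i*A − AE_i*A_2, A_3E_i* − E_i*A_3, A_2E_i* − E_i*A_2, AE_i* − E_i*A`. -/
def vecE {X : Type} [Fintype X] [DecidableEq X] (Γ : DRG X) (x : X)
    (a : Fin 4) (i : Fin Γ.D) : Matrix X X ℂ :=
  ![Γ.A 2 * Γ.Estar x ((i : ℕ) + 1) * Γ.A 1 - Γ.A 1 * Γ.Estar x ((i : ℕ) + 1) * Γ.A 2,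
    Γ.A 3 * Γ.Estar x ((i : ℕ) + 1) - Γ.Estar x ((i : ℕ) + 1) * Γ.A 3,
    Γ.A 2 * Γ.Estar x ((i : ℕ) + 1) - Γ.Estar x ((i : ℕ) + 1) * Γ.A 2,
    Γ.A 1 * Γ.Estar x ((i : ℕ) + 1) - Γ.Estar x ((i : ℕ) + 1) * Γ.A 1] a

/-- The `4D` matrices `A_2A_i*A − AA_i*A_2, A_3A_i* − A_i*A_3, A_2A_i* − A_i*A_2, AA_i* − A_i*A`. -/
def vecA {X : Type} [Fintype X] [DecidableEq X] {Γ : DRG X} (I : IdemSys Γ) (x : X)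
    (a : Fin 4) (i : Fin Γ.D) : Matrix X X ℂ :=
  ![Γ.A 2 * I.Astar x i.succ * Γ.A 1 - Γ.A 1 * I.Astar x i.succ * Γ.A 2,
    Γ.A 3 * I.Astar x i.succ - I.Astar x i.succ * Γ.A 3,
    Γ.A 2 * I.Astar x i.succ - I.Astar x i.succ * Γ.A 2,
    Γ.A 1 * I.Astar x i.succ - I.Astar x i.succ * Γ.A 1] a

namespace DRG

variable {X : Type} [Fintype X] [DecidableEq X] (Γ : DRG X)

theorem A_apply (i : ℕ) (y z : X) :
    Γ.A i y z = if Γ.G.dist y z = i then (1 : ℂ) else 0 := rfl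

theorem A_apply_comm (i : ℕ) (y z : X) : Γ.A i y z = Γ.A i z y := by
  simp only [A_apply, SimpleGraph.dist_comm]

theorem star_A_apply (i : ℕ) (y z : X) : starRingEnd ℂ (Γ.A i y z) = Γ.A i y z := by
  rw [A_apply]; split_ifs <;> simp

theorem A_mul_apply_dist (i : ℕ) (y z : X) (f : ℕ → ℂ) :
    Γ.A i y z * f (Γ.G.dist y z) = Γ.A i y z * f i := by
  rw [A_apply]; split_ifs with h <;> simp [h]

theorem sum_A_mul (y z : X) (f : ℕ → ℂ) :
    ∑ l : Fin (Γ.D + 1), Γ.A l y z * f l = f (Γ.G.dist y z) := by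
  have h := Γ.hdiam_le y z
  rw [Finset.sum_eq_single ⟨Γ.G.dist y z, by omega⟩]
  · simp [A_apply]
  · intro l _ hl
    have : Γ.G.dist y z ≠ l := fun e => hl (Fin.ext e.symm)
    simp [A_apply, this]
  · simp

theorem sum_A_mul_A {i j : ℕ} (hi : i ≤ Γ.D) (hj : j ≤ Γ.D) (y z : X) :
    ∑ w, Γ.A i y w * Γ.A j z w = (Γ.p (Γ.G.dist y z) i j : ℂ) := by
  rw [← Γ.hp _ i j (Γ.hdiam_le y z) hi hj y z rfl, Nat.card_eq_fintype_card,
    Fintype.card_subtype, Finset.card_filter]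
  push_cast
  refine Finset.sum_congr rfl fun w _ => ?_
  simp only [A_apply, ← ite_and, mul_ite, mul_one, mul_zero]
  congr 1
  exact propext and_comm

theorem sum_A {i : ℕ} (hi : i ≤ Γ.D) (y : X) : ∑ w, Γ.A i y w = (Γ.kI i : ℂ) := by
  have h := Γ.sum_A_mul_A hi hi y y
  rw [SimpleGraph.dist_self] at h
  rw [kI, ← h]
  refine Finset.sum_congr rfl fun w _ => ?_
  rw [A_apply]; split_ifs <;> simp

theorem sum_sum_A_mul_A_mul_A {j s l : ℕ} (hj : j ≤ Γ.D) (hs : s ≤ Γ.D) (hl : l ≤ Γ.D) (x : X) :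
    ∑ u, ∑ v, Γ.A j x u * Γ.A s x v * Γ.A l u v = (Γ.kI j : ℂ) * Γ.p j s l := by
  rw [← Γ.sum_A hj x, Finset.sum_mul]
  refine Finset.sum_congr rfl fun u _ => ?_
  simp_rw [mul_assoc, ← Finset.mul_sum]
  rw [Γ.sum_A_mul_A hs hl, Γ.A_mul_apply_dist j x u fun n => (Γ.p n s l : ℂ)]

theorem kI_mul_p {j s l : ℕ} (hj : j ≤ Γ.D) (hs : s ≤ Γ.D) (hl : l ≤ Γ.D) :
    (Γ.kI j : ℂ) * Γ.p j s l = Γ.kI l * Γ.p l j s := by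
  have : Nonempty X := Γ.hconn.nonempty
  have hX : (Fintype.card X : ℂ) ≠ 0 := Nat.cast_ne_zero.2 Fintype.card_ne_zero
  apply mul_left_cancel₀ hX
  have h₁ : ∑ x, ∑ u, ∑ v, Γ.A j x u * Γ.A s x v * Γ.A l u v =
      (Fintype.card X : ℂ) * (Γ.kI j * Γ.p j s l) := by
    simp [Γ.sum_sum_A_mul_A_mul_A hj hs hl]
  have h₂ : ∑ u, ∑ v, ∑ x, Γ.A j x u * Γ.A s x v * Γ.A l u v =
      (Fintype.card X : ℂ) * (Γ.kI l * Γ.p l j s) := by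
    have (u v : X) : ∑ x, Γ.A j x u * Γ.A s x v * Γ.A l u v = Γ.A l u v * Γ.p l j s := by
      rw [← Finset.sum_mul, mul_comm]
      simp_rw [Γ.A_apply_comm j _ u, Γ.A_apply_comm s _ v]
      rw [Γ.sum_A_mul_A hj hs, Γ.A_mul_apply_dist l u v fun n => (Γ.p n j s : ℂ)]
    simp [this, ← Finset.sum_mul, Γ.sum_A hl]
  rw [← h₁, ← h₂, Finset.sum_comm]
  exact Finset.sum_congr rfl fun u _ => Finset.sum_comm

theorem A_mul_Estar_mul_A_apply (x : X) (i j h : ℕ) (y z : X) :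
    (Γ.A i * Γ.Estar x j * Γ.A h) y z = ∑ u, Γ.A i u y * Γ.A j x u * Γ.A h u z := by
  simp only [Estar, Matrix.mul_apply (M := Γ.A i * _), Matrix.mul_diagonal, ← A_apply,
    Γ.A_apply_comm i y]

theorem inn_A_mul_Estar_mul_A (x : X) {h i j r s t : ℕ} (hh : h ≤ Γ.D) (hi : i ≤ Γ.D)
    (hr : r ≤ Γ.D) (ht : t ≤ Γ.D) :
    inn (Γ.A i * Γ.Estar x j * Γ.A h) (Γ.A r * Γ.Estar x s * Γ.A t) =
      ∑ u, ∑ v, Γ.A j x u * Γ.A s x v *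
        ((Γ.p (Γ.G.dist u v) i r : ℂ) * Γ.p (Γ.G.dist u v) h t) := by
  simp only [inn, Matrix.trace, Matrix.diag, Matrix.mul_apply (M := (_)ᵀ),
    Matrix.transpose_apply, Matrix.map_apply, A_mul_Estar_mul_A_apply, map_sum, map_mul,
    star_A_apply, Finset.sum_mul_sum]
  calc _ = ∑ z, ∑ u, ∑ v, ∑ y, Γ.A i u y * Γ.A j x u * Γ.A h u z *
          (Γ.A r v y * Γ.A s x v * Γ.A t v z) := by
        refine Finset.sum_congr rfl fun z _ => ?_
        rw [Finset.sum_comm]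
        exact Finset.sum_congr rfl fun u _ => Finset.sum_comm
    _ = ∑ u, ∑ v, ∑ z, ∑ y, Γ.A i u y * Γ.A j x u * Γ.A h u z *
          (Γ.A r v y * Γ.A s x v * Γ.A t v z) := by
        rw [Finset.sum_comm]
        exact Finset.sum_congr rfl fun u _ => Finset.sum_comm
    _ = _ := by
        refine Finset.sum_congr rfl fun u _ => Finset.sum_congr rfl fun v _ => ?_
        rw [← Γ.sum_A_mul_A hi hr, ← Γ.sum_A_mul_A hh ht, Finset.sum_mul_sum, Finset.mul_sum,
          Finset.sum_comm]
        refine Finset.sum_congr rfl fun y _ => ?_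
        rw [Finset.mul_sum]
        exact Finset.sum_congr rfl fun z _ => by ring

end DRG

/-- `⟨A_iE_j*A_h, A_rE_s*A_t⟩ = Σ_{ℓ=0}^D k_ℓ p^ℓ_{ir} p^ℓ_{js} p^ℓ_{ht}`. -/
theorem stmt_8 {X : Type} [Fintype X] [DecidableEq X] (Γ : DRG X) (x : X) :
    ∀ h i j r s t : Fin (Γ.D + 1),
      DRG.inn (Γ.A (i : ℕ) * Γ.Estar x (j : ℕ) * Γ.A (h : ℕ))
          (Γ.A (r : ℕ) * Γ.Estar x (s : ℕ) * Γ.A (t : ℕ)) =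
        ∑ l : Fin (Γ.D + 1), (Γ.kI (l : ℕ) : ℂ) * (Γ.p (l : ℕ) (i : ℕ) (r : ℕ) : ℂ) *
          (Γ.p (l : ℕ) (j : ℕ) (s : ℕ) : ℂ) * (Γ.p (l : ℕ) (h : ℕ) (t : ℕ) : ℂ) := by
  intro h i j r s t
  rw [Γ.inn_A_mul_Estar_mul_A x h.is_le i.is_le r.is_le t.is_le]
  calc _ = ∑ l : Fin (Γ.D + 1), (∑ u, ∑ v, Γ.A j x u * Γ.A s x v * Γ.A l u v) *
        ((Γ.p l i r : ℂ) * Γ.p l h t) := by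
        simp_rw [← Γ.sum_A_mul _ _ fun n => (Γ.p n i r : ℂ) * Γ.p n h t, Finset.mul_sum,
          Finset.sum_mul]
        rw [Finset.sum_comm (s := (Finset.univ : Finset (Fin (Γ.D + 1))))]
        refine Finset.sum_congr rfl fun u _ => ?_
        rw [Finset.sum_comm]
        simp only [mul_assoc]
    _ = _ := by
        refine Finset.sum_congr rfl fun l _ => ?_
        rw [Γ.sum_sum_A_mul_A_mul_A j.is_le s.is_le l.is_le,
          Γ.kI_mul_p j.is_le s.is_le l.is_le]
        ring
end
end

section
/- Let Γ be a primitive distance-regular graph with diameter D ≥ 3. Then u_i(θ_j) ≠ 1 for all 1 ≤ i,j ≤ D. -/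
open Matrix BigOperators

noncomputable section

/-- A real function on a finite connected graph whose value at each vertex is the average of its
values over the (nonempty) neighbourhood is constant. -/
theorem SimpleGraph.Connected.eq_of_sum_neighbors_eq {X : Type} [Fintype X] {H : SimpleGraph X}
    (hH : H.Connected) (s : X → Finset X) (hs : ∀ x y, H.Adj x y → y ∈ s x) (f : X → ℝ)
    (hf : ∀ x, ∑ y ∈ s x, f y = (s x).card * f x) (x y : X) : f x = f y := by
  have : Nonempty X := ⟨x⟩
  obtain ⟨m, hm⟩ := Finite.exists_max f
  have step : ∀ u v, H.Adj u v → f u = f m → f v = f m := by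
    intro u v huv hu
    have h0 : ∑ w ∈ s u, (f m - f w) = 0 := by
      rw [Finset.sum_sub_distrib, hf u, hu]
      simp
    have h1 := (Finset.sum_eq_zero_iff_of_nonneg
      (fun w _ => sub_nonneg.mpr (hm w))).mp h0 v (hs u v huv)
    linarith
  have key : ∀ v, f v = f m := by
    intro v
    obtain ⟨p⟩ := hH.preconnected m v
    have : ∀ {a b : X}, H.Walk a b → f a = f m → f b = f m := by
      intro a b q
      induction q with
      | nil => exact id
      | cons h _ ih => exact fun ha => ih (step _ _ h ha)
    exact this p rfl
  rw [key x, key y]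

/-- The first step of a geodesic. -/
theorem SimpleGraph.Connected.exists_dist_eq_one_of_dist_eq_succ {X : Type} {G : SimpleGraph X}
    (hG : G.Connected) {y z : X} {n : ℕ} (h : G.dist y z = n + 1) :
    ∃ w, G.dist y w = 1 ∧ G.dist w z = n := by
  obtain ⟨p, hp⟩ := hG.exists_walk_length_eq_dist y z
  cases p with
  | nil => simp at h
  | @cons _ w _ hadj q =>
    have h1 := SimpleGraph.dist_eq_one_iff_adj.mpr hadj
    refine ⟨w, h1, ?_⟩
    have h2 := SimpleGraph.dist_le q
    have h3 := hG.dist_triangle (u := y) (v := w) (w := z)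
    rw [SimpleGraph.Walk.length_cons] at hp
    omega

namespace DRG

variable {X : Type} [Fintype X] [DecidableEq X]

theorem exists_dist_eq (Γ : DRG X) {n : ℕ} (hn : n ≤ Γ.D) : ∃ y z : X, Γ.G.dist y z = n := by
  induction hn using Nat.decreasingInduction with
  | self => exact Γ.hdiam
  | of_succ k _ ih =>
    obtain ⟨y, z, h⟩ := ih
    obtain ⟨w, _, hw⟩ := Γ.hconn.exists_dist_eq_one_of_dist_eq_succ h
    exact ⟨w, z, hw⟩

theorem card_filter_dist (Γ : DRG X) {h i j : ℕ} (hh : h ≤ Γ.D) (hi : i ≤ Γ.D) (hj : j ≤ Γ.D)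
    {y z : X} (hyz : Γ.G.dist y z = h) :
    (Finset.univ.filter fun w => Γ.G.dist y w = i ∧ Γ.G.dist z w = j).card = Γ.p h i j := by
  rw [← Γ.hp h i j hh hi hj y z hyz, Nat.card_eq_fintype_card, Fintype.card_subtype]

theorem card_sphere (Γ : DRG X) {i : ℕ} (hi : i ≤ Γ.D) (y : X) :
    (Finset.univ.filter fun w => Γ.G.dist y w = i).card = Γ.kI i := by
  rw [kI, ← Γ.card_filter_dist (Nat.zero_le _) hi hi (SimpleGraph.dist_self (v := y))]
  simp

theorem A_mul_A_apply (Γ : DRG X) {i j : ℕ} (hi : i ≤ Γ.D) (hj : j ≤ Γ.D) (y z : X) :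
    (Γ.A i * Γ.A j) y z = (Γ.p (Γ.G.dist y z) i j : ℂ) := by
  rw [← Γ.card_filter_dist (Γ.hdiam_le y z) hi hj rfl, Matrix.mul_apply, Finset.card_filter]
  push_cast
  refine Finset.sum_congr rfl fun w _ => ?_
  simp only [A, Matrix.of_apply, ite_and, SimpleGraph.dist_comm (u := w) (v := z)]
  split_ifs <;> simp

theorem p_one_ne_zero (Γ : DRG X) {n : ℕ} (hn : n + 1 ≤ Γ.D) : Γ.p (n + 1) 1 n ≠ 0 := by
  obtain ⟨y, z, h⟩ := Γ.exists_dist_eq hn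
  obtain ⟨w, hw1, hw2⟩ := Γ.hconn.exists_dist_eq_one_of_dist_eq_succ h
  rw [← Γ.card_filter_dist hn (by omega) (by omega) h]
  refine Finset.card_ne_zero.mpr ⟨w, ?_⟩
  simp [hw1, SimpleGraph.dist_comm (u := z), hw2]

theorem p_one_eq_zero (Γ : DRG X) {n : ℕ} (hn : n ≤ Γ.D) {y z : X}
    (h : Γ.G.dist y z + 1 < n ∨ n + 1 < Γ.G.dist y z) : Γ.p (Γ.G.dist y z) 1 n = 0 := by
  have hD := Γ.hD
  rw [← Γ.card_filter_dist (Γ.hdiam_le y z) (by omega) hn rfl, Finset.card_eq_zero,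
    Finset.filter_eq_empty_iff]
  rintro w - ⟨h1, h2⟩
  have t1 := Γ.hconn.dist_triangle (u := y) (v := w) (w := z)
  have t2 := Γ.hconn.dist_triangle (u := z) (v := y) (w := w)
  rw [SimpleGraph.dist_comm (u := w) (v := z)] at t1
  rw [SimpleGraph.dist_comm (u := z) (v := y)] at t2
  omega

theorem A_one_mul_A_succ (Γ : DRG X) {n : ℕ} (hn : n + 2 ≤ Γ.D) :
    Γ.A 1 * Γ.A (n + 1) = (Γ.cI (n + 2) : ℂ) • Γ.A (n + 2) + (Γ.aI (n + 1) : ℂ) • Γ.A (n + 1)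
      + (Γ.bI n : ℂ) • Γ.A n := by
  have hc : Γ.cI (n + 2) = Γ.p (n + 2) 1 (n + 1) := by simp [cI, hn]
  have hb : Γ.bI n = Γ.p n 1 (n + 1) := by
    rw [bI, if_pos (by omega)]
  ext y z
  rw [Γ.A_mul_A_apply (by omega) (by omega), hc, hb, aI]
  simp only [Matrix.add_apply, Matrix.smul_apply, A, Matrix.of_apply, smul_eq_mul]
  by_cases h2 : Γ.G.dist y z = n + 2
  · simp [h2]
  by_cases h1 : Γ.G.dist y z = n + 1
  · simp [h1]
  by_cases h0 : Γ.G.dist y z = n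
  · simp [h0]
  rw [Γ.p_one_eq_zero (by omega) (by omega)]
  simp [h0, h1, h2]

theorem A_zero (Γ : DRG X) : Γ.A 0 = 1 := by
  ext y z
  simp [A, Matrix.one_apply, Γ.hconn.dist_eq_zero_iff]

theorem A_one_eq_adjMatrix (Γ : DRG X) [DecidableRel Γ.G.Adj] : Γ.A 1 = Γ.G.adjMatrix ℂ := by
  ext y z
  simp [A, SimpleGraph.adjMatrix_apply]

open Classical in
theorem A_one_pow_apply_of_lt (Γ : DRG X) {n : ℕ} {y z : X} (h : n < Γ.G.dist y z) :
    (Γ.A 1 ^ n) y z = 0 := by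
  rw [A_one_eq_adjMatrix, SimpleGraph.adjMatrix_pow_apply_eq_card_walk, Nat.cast_eq_zero,
    Fintype.card_eq_zero_iff]
  refine ⟨fun ⟨p, hp⟩ => ?_⟩
  have := SimpleGraph.dist_le p
  have hp' : p.length = n := hp
  omega

open Classical in
theorem A_one_pow_dist_apply_ne_zero (Γ : DRG X) (y z : X) :
    (Γ.A 1 ^ Γ.G.dist y z) y z ≠ 0 := by
  rw [A_one_eq_adjMatrix, SimpleGraph.adjMatrix_pow_apply_eq_card_walk, Nat.cast_ne_zero]
  obtain ⟨p, hp⟩ := Γ.hconn.exists_walk_length_eq_dist y z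
  exact ne_of_gt (Fintype.card_pos_iff.mpr ⟨⟨p, hp⟩⟩)

/-- The adjacency matrix is not a root of a monic polynomial of degree `D`. -/
theorem aeval_A_one_ne_zero (Γ : DRG X) {q : Polynomial ℂ} (hq : q.Monic)
    (hdeg : q.natDegree = Γ.D) : Polynomial.aeval (Γ.A 1) q ≠ 0 := by
  obtain ⟨y, z, h⟩ := Γ.hdiam
  intro h0
  have h1 := congrFun (congrFun h0 y) z
  rw [Polynomial.aeval_eq_sum_range, Finset.sum_range_succ, Matrix.add_apply, Matrix.sum_apply,
    Finset.sum_eq_zero, hq.coeff_natDegree, hdeg, ← h] at h1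
  · simp [Γ.A_one_pow_dist_apply_ne_zero y z] at h1
  · intro n hn
    rw [Matrix.smul_apply, Γ.A_one_pow_apply_of_lt, smul_zero]
    rw [Finset.mem_range] at hn
    omega

end DRG

namespace IdemSys

variable {X : Type} [Fintype X] [DecidableEq X] {Γ : DRG X}

theorem A_mul_E (I : IdemSys Γ) (j : Fin (Γ.D + 1)) {i : ℕ} (hi : i ≤ Γ.D) :
    Γ.A i * I.E j = (((Γ.vpoly i).eval (I.θ j) : ℝ) : ℂ) • I.E j := by
  induction i using Nat.strong_induction_on with
  | _ i ih =>
    match i, hi, ih with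
    | 0, _, _ => simp [DRG.A_zero, DRG.vpoly]
    | 1, _, _ => simpa [DRG.vpoly] using I.hEig j
    | n + 2, hi, ih =>
      have hc : (Γ.cI (n + 2) : ℂ) ≠ 0 := by
        have := Γ.p_one_ne_zero hi
        simpa [DRG.cI, hi] using this
      have e1 := ih (n + 1) (by omega) (by omega)
      have e0 := ih n (by omega) (by omega)
      have hrec := congrArg (· * I.E j) (Γ.A_one_mul_A_succ hi)
      simp only [Matrix.mul_assoc, Matrix.add_mul, Matrix.smul_mul, e1, e0, Matrix.mul_smul,
        I.hEig j] at hrec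
      have h2 : (Γ.cI (n + 2) : ℂ) • (Γ.A (n + 2) * I.E j) =
          (Γ.cI (n + 2) : ℂ) • (((Γ.vpoly (n + 2)).eval (I.θ j) : ℝ) : ℂ) • I.E j := by
        rw [add_assoc, ← sub_eq_iff_eq_add] at hrec
        rw [← hrec]
        simp only [smul_smul, ← add_smul, ← sub_smul]
        congr 1
        simp only [DRG.vpoly, Polynomial.eval_smul, Polynomial.eval_sub, Polynomial.eval_mul,
          Polynomial.eval_X, smul_eq_mul]
        push_cast
        field_simp
        ring
      exact smul_right_injective _ hc h2

theorem aeval_A_one_mul_E (I : IdemSys Γ) (j : Fin (Γ.D + 1)) (q : Polynomial ℂ) :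
    Polynomial.aeval (Γ.A 1) q * I.E j = q.eval (I.θ j : ℂ) • I.E j := by
  induction q using Polynomial.induction_on' with
  | add p q hp hq => simp [Matrix.add_mul, hp, hq, add_smul]
  | monomial n a =>
    have hpow : Γ.A 1 ^ n * I.E j = (I.θ j : ℂ) ^ n • I.E j := by
      induction n with
      | zero => simp
      | succ n ih => rw [pow_succ, Matrix.mul_assoc, I.hEig, Matrix.mul_smul, ih, smul_smul,
          pow_succ']
    rw [Polynomial.aeval_monomial, Polynomial.eval_monomial, ← Algebra.smul_def,
      Matrix.smul_mul, hpow, smul_smul]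

theorem E_ne_zero (I : IdemSys Γ) (j : Fin (Γ.D + 1)) : I.E j ≠ 0 := by
  intro hj
  let q : Polynomial ℂ := ∏ i ∈ Finset.univ.erase j, (Polynomial.X - Polynomial.C (I.θ i : ℂ))
  have hq : q.Monic := Polynomial.monic_prod_X_sub_C _ _
  have hdeg : q.natDegree = Γ.D := by
    simp [q, Polynomial.natDegree_finsetProd_X_sub_C_eq_card]
  refine Γ.aeval_A_one_ne_zero hq hdeg ?_
  rw [← Matrix.mul_one (Polynomial.aeval (Γ.A 1) q), ← I.hEsum, Matrix.mul_sum]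
  refine Finset.sum_eq_zero fun i _ => ?_
  rw [I.aeval_A_one_mul_E]
  by_cases hij : i = j
  · rw [hij, hj, smul_zero]
  · have : q.eval (I.θ i : ℂ) = 0 := by
      rw [Polynomial.eval_prod]
      exact Finset.prod_eq_zero (Finset.mem_erase.mpr ⟨hij, Finset.mem_univ i⟩) (by simp)
    rw [this, zero_smul]

theorem E_apply_const_of_A_mul_eq (hprim : Γ.Primitive) (I : IdemSys Γ) {i : ℕ} (hi1 : 1 ≤ i)
    (hi : i ≤ Γ.D) {j : Fin (Γ.D + 1)} (h : Γ.A i * I.E j = (Γ.kI i : ℂ) • I.E j) (x y z : X) :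
    I.E j y x = I.E j z x := by
  have hsum : ∀ w, ∑ v ∈ Finset.univ.filter (fun v => Γ.G.dist w v = i), I.E j v x =
      (Γ.kI i : ℂ) * I.E j w x := by
    intro w
    have := congrFun (congrFun h w) x
    simpa [Matrix.mul_apply, DRG.A, Finset.sum_filter] using this
  have hadj : ∀ u v : X, (SimpleGraph.fromRel fun y z => Γ.G.dist y z = i).Adj u v →
      v ∈ Finset.univ.filter (fun v => Γ.G.dist u v = i) := by
    intro u v huv
    simpa [SimpleGraph.dist_comm (u := v) (v := u)] using huv.2
  apply Complex.ext
  · refine (hprim i hi1 hi).eq_of_sum_neighbors_eq _ hadj (fun v => (I.E j v x).re) ?_ y z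
    intro w
    rw [Γ.card_sphere hi, ← Complex.re_sum, hsum]
    simp
  · refine (hprim i hi1 hi).eq_of_sum_neighbors_eq _ hadj (fun v => (I.E j v x).im) ?_ y z
    intro w
    rw [Γ.card_sphere hi, ← Complex.im_sum, hsum]
    simp

end IdemSys

/-- if `Γ` is primitive then `u_i(θ_j) ≠ 1` for `1 ≤ i, j ≤ D`. -/
theorem stmt_15 {X : Type} [Fintype X] [DecidableEq X] (Γ : DRG X) (hprim : Γ.Primitive)
    (I : IdemSys Γ) :
    ∀ i : ℕ, 1 ≤ i → i ≤ Γ.D → ∀ j : Fin (Γ.D + 1), 1 ≤ (j : ℕ) →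
      (Γ.upoly i).eval (I.θ j) ≠ 1 := by
  intro i hi1 hi j hj hu
  rw [DRG.upoly, Polynomial.eval_smul, smul_eq_mul] at hu
  have hv : (Γ.vpoly i).eval (I.θ j) = Γ.kI i := by
    rw [inv_mul_eq_one₀ (inv_eq_zero.not.mp (left_ne_zero_of_mul_eq_one hu))] at hu
    exact hu.symm
  have hA := I.A_mul_E j hi
  rw [hv, Complex.ofReal_natCast] at hA
  have hconst := I.E_apply_const_of_A_mul_eq hprim hi1 hi hA
  have hne : (0 : Fin (Γ.D + 1)) ≠ j := by
    rintro rfl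
    simp at hj
  apply I.E_ne_zero j
  ext y x
  have h0 := congrFun (congrFun (I.hEmul 0 j) y) x
  have hcard : (Fintype.card X : ℂ) ≠ 0 :=
    Nat.cast_ne_zero.mpr (Fintype.card_pos_iff.mpr ⟨y⟩).ne'
  rw [if_neg hne, I.hE0, Matrix.smul_mul, Matrix.smul_apply, Matrix.mul_apply,
    Finset.sum_congr rfl fun w _ => by rw [Matrix.of_apply, one_mul, hconst x w y]] at h0
  simpa [hcard] using h0
end
end
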